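/- Fix integers N and k with 3 ≤ k and 2k ≤ N, and complex numbers c₄₀, c₂₀, c₁₀. On R_N := MvPolynomial (ZMod N) ℂ define H := Σ_i ( a†_i∘a_{i+1} + a†_{i+1}∘a_i + c₄₀·(a†_i)⁴ + c₂₀·(a†_i)² + c₁₀·a†_i ). For integers l ≥ 2 and 0 ≤ n ≤ l−1 define D_{l,n} := 24·Σ_i Σ_{m=1}^{l−n} (−1)^{l−n−m}·σ(1, m, n+m, l)·a†_i ∘ a†_{i+m−1} ∘ a†_{i+n+m−1} ∘ a†_{i+l−1}, where for a nondecreasing 4-tuple the symmetry factor σ(i₁,i₂,i₃,i₄) is the reciprocal of the product of the factorials of the multiplicities of the repeated values (so σ = 1 if all entries are distinct, 1/2! for one pair, 1/(2!·2!) for two pairs, 1/3! for a triple, 1/4! for a quadruple). Define Q_k := Σ_i [ a†_i∘a_{i+k−1} + (−1)^k·a_i∘a†_{i+k−1} + a†_i∘a_{i+k−3} + (−1)^k·a_i∘a†_{i+k−3} + (1 + (−1)^k)·( c₂₀·a†_i∘a†_{i+k−2} + c₁₀·a†_i ) ] + c₄₀·Σ_{n=0}^{⌊k/2⌋−1} D_{k−n−1,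 n}. Then ⁅Q_k, H⁆ = 0; i.e., the degree-4 model with c₁₁ = 0 is completely integrable (Type C), possessing a k-local charge for every 3 ≤ k ≤ N/2. -/

import Mathlib

open MvPolynomial

noncomputable section

/-- Creation operator at site `i` of the periodic bosonic chain:
multiplication by the variable `X i` on `MvPolynomial (ZMod N) ℂ`. -/
def ad (N : ℕ) (i : ZMod N) : Module.End ℂ (MvPolynomial (ZMod N) ℂ) :=
  LinearMap.mulLeft ℂ (X i)

/-- Annihilation operator at site `i`: the partial derivative `pderiv i`. -/
def an (N : ℕ) (i : ZMod N) : Module.End ℂ (MvPolynomial (ZMod N) ℂ) :=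
  (pderiv i).toLinearMap

/-- Symmetry factor of a 4-tuple: the reciprocal of the product of the factorials of
the multiplicities of the repeated values (1 if all distinct, `1/2!` for one pair,
`1/(2!·2!)` for two pairs, `1/3!` for a triple, `1/4!` for a quadruple). -/
def sigma4 (i1 i2 i3 i4 : ℕ) : ℂ :=
  ((∏ a ∈ ({i1, i2, i3, i4} : Multiset ℕ).toFinset,
      (({i1, i2, i3, i4} : Multiset ℕ).count a).factorial : ℕ) : ℂ)⁻¹

/-- The quartic building block
`D_{l,n} = 24 Σ_i Σ_{m=1}^{l−n} (−1)^{l−n−m} σ(1,m,n+m,l)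
  a†_i a†_{i+m−1} a†_{i+n+m−1} a†_{i+l−1}`. -/
def Dop (N : ℕ) [NeZero N] (l n : ℕ) : Module.End ℂ (MvPolynomial (ZMod N) ℂ) :=
  (24 : ℂ) • ∑ i : ZMod N, ∑ m ∈ Finset.Icc 1 (l - n),
    (((-1 : ℂ) ^ (l - n - m)) * sigma4 1 m (n + m) l) •
      (ad N i * ad N (i + ((m - 1 : ℕ) : ZMod N))
        * ad N (i + ((n + m - 1 : ℕ) : ZMod N)) * ad N (i + ((l - 1 : ℕ) : ZMod N)))

lemma sigma4_of_lt {a b c d : ℕ} (h₁ : a < b) (h₂ : b < c) (h₃ : c < d) :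
    sigma4 a b c d = 1 := by
  have e : ({a, b, c, d} : Multiset ℕ).toFinset = {a, b, c, d} := by ext; simp
  rw [sigma4, e, Finset.prod_insert (by simp; lia), Finset.prod_insert (by simp; lia),
    Finset.prod_insert (by simp; lia), Finset.prod_singleton]
  simp [h₁.ne, h₁.ne', h₂.ne, h₂.ne', h₃.ne, h₃.ne',
    (h₁.trans h₂).ne, (h₁.trans h₂).ne', (h₂.trans h₃).ne, (h₂.trans h₃).ne',
    (h₁.trans (h₂.trans h₃)).ne, (h₁.trans (h₂.trans h₃)).ne']

lemma sigma4_left {a c d : ℕ} (h₂ : a < c) (h₃ : c < d) : sigma4 a a c d = 1 / 2 := by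
  have e : ({a, a, c, d} : Multiset ℕ).toFinset = {a, c, d} := by ext; simp
  rw [sigma4, e, Finset.prod_insert (by simp; lia), Finset.prod_insert (by simp; lia),
    Finset.prod_singleton]
  simp [h₂.ne, h₂.ne', h₃.ne, h₃.ne',
    (h₂.trans h₃).ne, (h₂.trans h₃).ne']

lemma sigma4_mid {a c d : ℕ} (h₂ : a < c) (h₃ : c < d) : sigma4 a c c d = 1 / 2 := by
  have e : ({a, c, c, d} : Multiset ℕ).toFinset = {a, c, d} := by ext; simp
  rw [sigma4, e, Finset.prod_insert (by simp; lia), Finset.prod_insert (by simp; lia),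
    Finset.prod_singleton]
  simp [h₂.ne, h₂.ne', h₃.ne, h₃.ne',
    (h₂.trans h₃).ne, (h₂.trans h₃).ne']

lemma sigma4_right {a c d : ℕ} (h₂ : a < c) (h₃ : c < d) : sigma4 a c d d = 1 / 2 := by
  have e : ({a, c, d, d} : Multiset ℕ).toFinset = {a, c, d} := by ext; simp
  rw [sigma4, e, Finset.prod_insert (by simp; lia), Finset.prod_insert (by simp; lia),
    Finset.prod_singleton]
  simp [h₂.ne, h₂.ne', h₃.ne, h₃.ne',
    (h₂.trans h₃).ne, (h₂.trans h₃).ne']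

lemma sigma4_two_pairs {a d : ℕ} (h : a < d) : sigma4 a a d d = 1 / 4 := by
  have e : ({a, a, d, d} : Multiset ℕ).toFinset = {a, d} := by ext; simp
  rw [sigma4, e, Finset.prod_insert (by simp; lia), Finset.prod_singleton]
  simp [h.ne, h.ne']


lemma sigma4_triple_left {a d : ℕ} (h : a < d) : sigma4 a a a d = 1 / 6 := by
  have e : ({a, a, a, d} : Multiset ℕ).toFinset = {a, d} := by ext; simp
  rw [sigma4, e, Finset.prod_insert (by simp; lia), Finset.prod_singleton]
  simp [h.ne, h.ne', Nat.factorial]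

lemma sigma4_triple_right {a d : ℕ} (h : a < d) : sigma4 a d d d = 1 / 6 := by
  have e : ({a, d, d, d} : Multiset ℕ).toFinset = {a, d} := by ext; simp
  rw [sigma4, e, Finset.prod_insert (by simp; lia), Finset.prod_singleton]
  simp [h.ne, h.ne', Nat.factorial]

section Layers

variable {E : Type*} [AddCommGroup E] [Module ℂ E]

/-- The alternating sum of `F p n q` over the antidiagonal `p + q = M`. -/
def altSum (F : ℤ → ℤ → ℤ → E) (n : ℤ) (M : ℕ) : E :=
  ∑ j ∈ Finset.range (M + 1), (-1 : ℂ) ^ j • F (M - j) n j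

/-- The alternating sum of `F p n q` over the antidiagonal `p + q = M`, weighted by the
symmetry factors of the 4-tuples with consecutive gaps `p, n, q`. -/
def layer (F : ℤ → ℤ → ℤ → E) (n M : ℕ) : E :=
  ∑ j ∈ Finset.range (M + 1),
    ((-1 : ℂ) ^ j * (24 * sigma4 1 (M - j + 1) (n + (M - j + 1)) (M + n + 1))) • F (M - j) n j

lemma layer_pos (F : ℤ → ℤ → ℤ → E) {n M : ℕ} (hn : 0 < n) (hM : 0 < M) :
    layer F n M = (24 : ℂ) • altSum F n M - (12 : ℂ) • F M n 0
      - (12 * (-1 : ℂ) ^ M) • F 0 n M := by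
  obtain ⟨M, rfl⟩ := Nat.exists_eq_add_of_lt hM
  rw [zero_add, layer, altSum, Finset.sum_range_succ, Finset.sum_range_succ',
    Finset.sum_range_succ (n := M + 1), Finset.sum_range_succ' (n := M),
    Finset.sum_congr rfl (g := fun j : ℕ ↦ (24 : ℂ) •
      ((-1 : ℂ) ^ (j + 1) • F (((M + 1 : ℕ) : ℤ) - ((j + 1 : ℕ) : ℤ)) n ((j + 1 : ℕ) : ℤ))),
    ← Finset.smul_sum]
  · rw [show M + 1 - 0 + 1 = M + 2 by lia, show n + (M + 2) = M + 1 + n + 1 by lia,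
      show M + 1 - (M + 1) + 1 = 1 by lia, sigma4_right (by lia) (by lia),
      sigma4_left (by lia) (by lia)]
    simp only [sub_self, Nat.cast_zero, sub_zero]
    module
  · intro j hj
    have := Finset.mem_range.1 hj
    rw [sigma4_of_lt (by lia) (by lia) (by lia)]
    module

lemma layer_zero_right (F : ℤ → ℤ → ℤ → E) {n : ℕ} (hn : 0 < n) :
    layer F n 0 = (6 : ℂ) • F 0 n 0 := by
  simp only [layer, Finset.sum_range_one, zero_add, zero_tsub]
  rw [sigma4_two_pairs (by lia)]
  norm_num

lemma layer_zero_left (F : ℤ → ℤ → ℤ → E) {M : ℕ} (hM : 0 < M) :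
    layer F 0 M = (12 : ℂ) • altSum F 0 M - (8 : ℂ) • F M 0 0
      - (8 * (-1 : ℂ) ^ M) • F 0 0 M := by
  obtain ⟨M, rfl⟩ := Nat.exists_eq_add_of_lt hM
  rw [zero_add, layer, altSum, Finset.sum_range_succ, Finset.sum_range_succ',
    Finset.sum_range_succ (n := M + 1), Finset.sum_range_succ' (n := M),
    Finset.sum_congr rfl (g := fun j : ℕ ↦ (12 : ℂ) •
      ((-1 : ℂ) ^ (j + 1) • F (((M + 1 : ℕ) : ℤ) - ((j + 1 : ℕ) : ℤ)) 0 ((j + 1 : ℕ) : ℤ))),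
    ← Finset.smul_sum]
  · rw [show M + 1 - 0 + 1 = M + 2 by lia, show 0 + (M + 2) = M + 1 + 0 + 1 by lia,
      show M + 1 - (M + 1) + 1 = 1 by lia, sigma4_triple_right (by lia), zero_add,
      sigma4_triple_left (by lia)]
    simp only [sub_self, Nat.cast_zero, sub_zero]
    module
  · intro j hj
    have := Finset.mem_range.1 hj
    rw [zero_add, sigma4_mid (by lia) (by lia)]
    simp only [Nat.cast_zero]
    module

lemma sum_range_neg_one_pow_smul_add_succ (c : ℕ → E) (M : ℕ) :
    ∑ j ∈ Finset.range (M + 1), (-1 : ℂ) ^ j • (c j + c (j + 1))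
      = c 0 + (-1 : ℂ) ^ M • c (M + 1) := by
  induction M with
  | zero => simp
  | succ M ih => rw [Finset.sum_range_succ, ih]; module

/-- `F` depends only on the underlying multiset of the 4-tuple with gaps `p, n, q`. -/
structure IsGapSymmetric (F : ℤ → ℤ → ℤ → E) : Prop where
  left : ∀ p n q, F p n q = F (-p) (p + n) q
  mid : ∀ p n q, F p n q = F (p + n) (-n) (n + q)
  right : ∀ p n q, F p n q = F p (n + q) (-q)

/-- `Δ` acts on `F` by summing over all unit displacements of the four entries of the tuple. -/
def IsHopping (Δ : E →ₗ[ℂ] E) (F : ℤ → ℤ → ℤ → E) : Prop :=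
  ∀ p n q, Δ (F p n q) = F (p + 1) n q + F (p - 1) n q + F (p + 1) (n - 1) q
    + F (p - 1) (n + 1) q + F p (n + 1) (q - 1) + F p (n - 1) (q + 1) + F p n (q + 1)
    + F p n (q - 1)

variable {Δ : E →ₗ[ℂ] E} {F : ℤ → ℤ → ℤ → E}

lemma IsHopping.map_altSum (h : IsHopping Δ F) (n : ℤ) (M : ℕ) :
    Δ (altSum F n M) = F (M + 1) n 0 + F M n (-1) + F (M + 1) (n - 1) 0 + F M (n + 1) (-1)
      + (-1 : ℂ) ^ M • (F 0 n (M + 1) + F (-1) n M + F 0 (n - 1) (M + 1) + F (-1) (n + 1) M) := by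
  have key := sum_range_neg_one_pow_smul_add_succ (fun j : ℕ ↦ F (M + 1 - j) n j + F (M - j) n (j - 1)
    + F (M + 1 - j) (n - 1) j + F (M - j) (n + 1) (j - 1)) M
  have e : (M : ℤ) - (M + 1 : ℕ) = -1 := by push_cast; ring
  have e' : (M : ℤ) + 1 - (M + 1 : ℕ) = 0 := by push_cast; ring
  have e'' : ((M + 1 : ℕ) : ℤ) - 1 = M := by push_cast; ring
  rw [e, e', e''] at key
  simp only [Nat.cast_zero, sub_zero, zero_sub, Nat.cast_succ] at key
  rw [← key, altSum, map_sum]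
  refine Finset.sum_congr rfl fun j _ ↦ ?_
  rw [map_smul, h, show (M : ℤ) + 1 - j = M - j + 1 by ring, show (M : ℤ) - (j + 1) = M - j - 1 by ring,
    show (M : ℤ) + 1 - (j + 1) = M - j by ring, show (j : ℤ) + 1 - 1 = j by ring]
  module

/-- The terms left over at the two ends of an antidiagonal after telescoping. -/
def edge (F : ℤ → ℤ → ℤ → E) (K n : ℕ) : E :=
  F (K - 2 * n + 1) n 0 + F (K - 2 * n + 1) (n - 1) 0
    + (-1 : ℂ) ^ K • (F 0 n (K - 2 * n + 1) + F 0 (n - 1) (K - 2 * n + 1))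

lemma IsHopping.map_layer (h : IsHopping Δ F) (hF : IsGapSymmetric F) {K n : ℕ} (hn : 0 < n)
    (hK : 2 * n < K) :
    Δ (layer F n (K - 2 * n)) = (12 : ℂ) • (edge F K n - edge F K (n + 1)) := by
  obtain ⟨M, rfl⟩ := Nat.exists_eq_add_of_lt hK
  rw [show 2 * n + M + 1 - 2 * n = M + 1 by lia, layer_pos F hn (by lia : 0 < M + 1),
    map_sub, map_sub, map_smul, map_smul, map_smul, h.map_altSum, h, h, edge, edge]
  have s : (-1 : ℂ) ^ (2 * n + M + 1) = (-1) ^ (M + 1) := by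
    rw [add_assoc, pow_add, pow_mul]; simp
  rw [s]
  have a1 := hF.right (M + 1) n (-1)
  have a2 := hF.right (M + 1) (n + 1) (-1)
  have b1 := hF.left (-1) n (M + 1)
  have b2 := hF.left (-1) (n + 1) (M + 1)
  push_cast
  ring_nf at a1 a2 b1 b2 ⊢
  rw [a1, a2, b1, b2]
  module

lemma IsHopping.map_layer_zero_right (h : IsHopping Δ F) (hF : IsGapSymmetric F) {n : ℕ}
    (hn : 0 < n) : Δ (layer F n 0) = (12 : ℂ) • edge F (2 * n) n := by
  rw [layer_zero_right F hn, map_smul, h, edge, pow_mul]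
  have a1 := hF.right 0 n (-1)
  have a2 := hF.right 0 (n + 1) (-1)
  have b1 := hF.left (-1) n 0
  have b2 := hF.left (-1) (n + 1) 0
  push_cast
  ring_nf at a1 a2 b1 b2 ⊢
  rw [a1, a2, b1, b2]
  module

lemma IsHopping.map_layer_zero_left (h : IsHopping Δ F) (hF : IsGapSymmetric F) {K : ℕ}
    (hK : 0 < K) :
    Δ (layer F 0 K) = (4 : ℂ) • (F (K + 1) 0 0 + F (K - 1) 0 0
      + (-1 : ℂ) ^ K • (F 0 0 (K + 1) + F 0 0 (K - 1))) - (12 : ℂ) • edge F K 1 := by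
  rw [layer_zero_left F hK, map_sub, map_sub, map_smul, map_smul, map_smul, h.map_altSum, h, h, edge]
  have a1 := hF.right K 0 (-1)
  have a2 := hF.right K 1 (-1)
  have a4 := hF.mid K (-1) 1
  have a5 := hF.mid (K + 1) (-1) 0
  have b1 := hF.left (-1) 0 K
  have b2 := hF.left (-1) 1 K
  have b4 := hF.mid 1 (-1) K
  have b5 := hF.mid 0 (-1) (K + 1)
  push_cast
  ring_nf at a1 a2 a4 a5 b1 b2 b4 b5 ⊢
  simp only [a1, a2, a4, a5, b1, b2, b4, b5]
  module

lemma IsHopping.map_sum_layer (h : IsHopping Δ F) (hF : IsGapSymmetric F) {K : ℕ} (hK : 0 < K) :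
    Δ (∑ n ∈ Finset.range (K / 2 + 1), layer F n (K - 2 * n)) =
      (4 : ℂ) • (F (K + 1) 0 0 + F (K - 1) 0 0
        + (-1 : ℂ) ^ K • (F 0 0 (K + 1) + F 0 0 (K - 1))) := by
  have key : ∀ r, 2 * r < K → Δ (∑ n ∈ Finset.range r, layer F (n + 1) (K - 2 * (n + 1))) =
      (12 : ℂ) • (edge F K 1 - edge F K (r + 1)) := by
    intro r
    induction r with
    | zero => simp
    | succ r ih =>
      intro hr
      rw [Finset.sum_range_succ, map_add, ih (by lia), h.map_layer hF r.succ_pos hr]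
      module
  rw [Finset.sum_range_succ', map_add, mul_zero, Nat.sub_zero, h.map_layer_zero_left hF hK]
  obtain ⟨r, rfl | rfl⟩ := Nat.even_or_odd' K
  · obtain ⟨r, rfl⟩ := Nat.exists_eq_succ_of_ne_zero (by lia : r ≠ 0)
    rw [Nat.mul_div_cancel_left _ two_pos, Finset.sum_range_succ, map_add,
      key r (by lia), Nat.sub_self, h.map_layer_zero_right hF r.succ_pos]
    module
  · have e : edge F (2 * r + 1) (r + 1) = 0 := by
      rw [edge, pow_succ, pow_mul]
      push_cast
      ring_nf
      simp
      abel
    rw [show (2 * r + 1) / 2 = r by lia, key r (by lia), e]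
    module

end Layers

section Operators

variable {N : ℕ}

/-- The hopping derivation `∑ i, X i ∂_{i+d}`, i.e. `X j ↦ X (j - d)`. -/
def hop (N : ℕ) (d : ZMod N) :
    Derivation ℂ (MvPolynomial (ZMod N) ℂ) (MvPolynomial (ZMod N) ℂ) :=
  mkDerivation ℂ fun j ↦ X (j - d)

@[simp] lemma hop_X (d j : ZMod N) : hop N d (X j) = X (j - d) := mkDerivation_X ..

lemma an_mul_ad (i j : ZMod N) :
    an N i * ad N j = ad N j * an N i + (if i = j then (1 : ℂ) else 0) • 1 := by
  refine LinearMap.ext fun f ↦ ?_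
  split_ifs with h
  · subst h
    simp [an, ad]
  · simp [an, ad, pderiv_X_of_ne (Ne.symm h)]

variable [NeZero N]

lemma sum_site_shift {A : Type*} [AddCommMonoid A] (d : ZMod N) (f : ZMod N → A) :
    ∑ i, f (i + d) = ∑ i, f i := Equiv.sum_comp (Equiv.addRight d) f

lemma sum_ad_mul_an (d : ZMod N) : ∑ i, ad N i * an N (i + d) = (hop N d).toLinearMap := by
  have h : ∑ i, (X i : MvPolynomial (ZMod N) ℂ) • pderiv (i + d) = hop N d := by
    refine derivation_ext fun j ↦ ?_
    rw [← Derivation.coeFnAddMonoidHom_apply, map_sum, Finset.sum_apply,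
      Finset.sum_eq_single (j - d)]
    · simp
    · intro i _ hi
      have : j ≠ i + d := fun h ↦ hi (by simp [h])
      simp [pderiv_X_of_ne this]
    · simp
  refine LinearMap.ext fun f ↦ ?_
  rw [← h, Derivation.coeFn_coe, ← Derivation.coeFnAddMonoidHom_apply, map_sum]
  simp [ad, an]

lemma exists_sum_an_mul_ad (d : ZMod N) :
    ∃ κ : ℂ, ∑ i, an N i * ad N (i + d) = (hop N (-d)).toLinearMap + κ • 1 := by
  simp_rw [an_mul_ad, Finset.sum_add_distrib, ← Finset.sum_smul, ← sum_ad_mul_an]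
  refine ⟨_, congrArg (· + _) ?_⟩
  rw [← sum_site_shift (-d)]
  simp

lemma lie_derivation_add_lmul {R : Type*} [CommRing R] [Algebra ℂ R] (D D' : Derivation ℂ R R)
    (κ : ℂ) (V W : R) (h : ⁅D, D'⁆ = 0) (hVW : D V = D' W) :
    ⁅D.toLinearMap + κ • (1 : Module.End ℂ R) + Algebra.lmul ℂ R W,
      D'.toLinearMap + Algebra.lmul ℂ R V⁆ = 0 := by
  refine LinearMap.ext fun f ↦ ?_
  have hf := congrArg (· f) h
  simp only [Derivation.commutator_apply, Derivation.zero_apply] at hf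
  simp [Ring.lie_def, hVW]
  linear_combination hf - mul_smul_comm κ V f

/-- The translation-invariant quartic polynomial with gaps `p, n, q`. -/
def quartic (N : ℕ) [NeZero N] (p n q : ℤ) : MvPolynomial (ZMod N) ℂ :=
  ∑ i : ZMod N, X i * X (i + p) * X (i + p + n) * X (i + p + n + q)

/-- The translation-invariant quadratic polynomial with gap `d`. -/
def quadratic (N : ℕ) [NeZero N] (d : ZMod N) : MvPolynomial (ZMod N) ℂ :=
  ∑ i : ZMod N, X i * X (i + d)

lemma isGapSymmetric_quartic : IsGapSymmetric (quartic N) where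
  left p n q := by
    rw [quartic, quartic,
      ← sum_site_shift (p : ZMod N) fun i ↦ X i * X (i + ((-p : ℤ) : ZMod N)) * _ * _]
    refine Finset.sum_congr rfl fun i _ ↦ ?_
    push_cast
    ring_nf
  mid p n q := by
    refine Finset.sum_congr rfl fun i _ ↦ ?_
    push_cast
    ring_nf
  right p n q := by
    refine Finset.sum_congr rfl fun i _ ↦ ?_
    push_cast
    ring_nf

lemma isHopping_quartic :
    IsHopping (hop N 1 + hop N (-1)).toLinearMap (quartic N) := by
  intro p n q
  have h₁ : quartic N (p + 1) n q = ∑ i : ZMod N,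
      X (i - 1) * X (i + p) * X (i + p + n) * X (i + p + n + q) := by
    rw [quartic, ← sum_site_shift (-1)]
    refine Finset.sum_congr rfl fun i _ ↦ ?_
    push_cast
    ring_nf
  have h₂ : quartic N (p - 1) n q = ∑ i : ZMod N,
      X (i + 1) * X (i + p) * X (i + p + n) * X (i + p + n + q) := by
    rw [quartic, ← sum_site_shift 1]
    refine Finset.sum_congr rfl fun i _ ↦ ?_
    push_cast
    ring_nf
  rw [h₁, h₂]
  simp only [quartic, map_sum, ← Finset.sum_add_distrib]
  refine Finset.sum_congr rfl fun i _ ↦ ?_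
  simp [Derivation.leibniz]
  ring_nf

lemma hop_sum_pow_four (d : ℤ) :
    hop N d (∑ i, X i ^ 4) = (4 : ℂ) • quartic N d 0 0 := by
  rw [quartic, ← sum_site_shift (-d : ZMod N) fun i ↦ X i * X (i + (d : ZMod N)) * _ * _,
    map_sum, Finset.smul_sum]
  refine Finset.sum_congr rfl fun i _ ↦ ?_
  simp [Derivation.leibniz_pow, ← sub_eq_add_neg, ofNat_smul_eq_nsmul ℂ]
  ring

lemma hop_neg_sum_pow_four (d : ℤ) :
    hop N (-d) (∑ i, X i ^ 4) = (4 : ℂ) • quartic N 0 0 d := by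
  rw [quartic, map_sum, Finset.smul_sum]
  refine Finset.sum_congr rfl fun i _ ↦ ?_
  simp [Derivation.leibniz_pow, ofNat_smul_eq_nsmul ℂ]
  ring

lemma quadratic_neg (d : ZMod N) : quadratic N (-d) = quadratic N d := by
  rw [quadratic, ← sum_site_shift d, quadratic]
  refine Finset.sum_congr rfl fun i _ ↦ ?_
  simp [mul_comm]

lemma hop_sum_sq (d : ZMod N) : hop N d (∑ i, X i ^ 2) = (2 : ℂ) • quadratic N d := by
  rw [← quadratic_neg, quadratic, map_sum, Finset.smul_sum]
  refine Finset.sum_congr rfl fun i _ ↦ ?_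
  simp [Derivation.leibniz_pow, ofNat_smul_eq_nsmul ℂ, sub_eq_add_neg]

lemma hop_sum_X (d : ZMod N) : hop N d (∑ i, X i) = ∑ i, X i := by
  rw [map_sum, ← sum_site_shift (-d) X]
  simp [sub_eq_add_neg]

lemma hop_quadratic (e d : ZMod N) :
    hop N e (quadratic N d) = quadratic N (d + e) + quadratic N (d - e) := by
  rw [quadratic, quadratic, ← sum_site_shift (-e) fun i ↦ X i * X (i + (d + e)), quadratic,
    ← Finset.sum_add_distrib, map_sum]
  refine Finset.sum_congr rfl fun i _ ↦ ?_
  simp [Derivation.leibniz]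
  ring_nf

lemma Dop_eq (M n : ℕ) :
    Dop N (M + n + 1) n = Algebra.lmul ℂ _ (layer (quartic N) n M) := by
  have had (i : ZMod N) : ad N i = Algebra.lmul ℂ _ (X i) := rfl
  rw [Dop, Finset.sum_comm, show M + n + 1 - n = M + 1 by lia, Finset.smul_sum, layer, map_sum,
    Finset.range_eq_Ico, Finset.sum_bij' (fun m _ ↦ M + 1 - m) (fun j _ ↦ M + 1 - j)]
  on_goal 5 =>
    intro m hm
    obtain ⟨q, hq⟩ : ∃ q, M + 1 = m + q := Nat.exists_eq_add_of_le (Finset.mem_Icc.1 hm).2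
    obtain ⟨p, rfl⟩ : ∃ p, m = p + 1 := Nat.exists_eq_succ_of_ne_zero (by simp at hm; lia)
    obtain rfl : M = p + q := by lia
    rw [← Finset.smul_sum, smul_smul, map_smul, quartic, map_sum]
    rw [show p + q + 1 - (p + 1) = q by lia, show p + q - q = p by lia]
    congr 1
    · ring
    · refine Finset.sum_congr rfl fun i _ ↦ ?_
      simp only [had, ← map_mul]
      rw [show n + (p + 1) - 1 = p + n by lia]
      push_cast [Nat.add_sub_cancel]
      ring_nf
  all_goals
    intro m hm
    simp at hm ⊢
    lia

end Operators

/-- The degree-4 model with `c₁₁ = 0` is completely integrable (Type C):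
the displayed `Q_k` is a k-local conserved charge for every `3 ≤ k ≤ N/2`. -/
theorem degree4_typeC_k_local_charge (N k : ℕ) [NeZero N]
    (hk : 3 ≤ k) (hkN : 2 * k ≤ N)
    (c40 c20 c10 : ℂ)
    (H Q : Module.End ℂ (MvPolynomial (ZMod N) ℂ))
    (hH : H = ∑ i : ZMod N,
        (ad N i * an N (i + 1) + ad N (i + 1) * an N i
          + c40 • (ad N i) ^ 4 + c20 • (ad N i) ^ 2 + c10 • ad N i))
    (hQ : Q = (∑ i : ZMod N,
        (ad N i * an N (i + ((k - 1 : ℕ) : ZMod N))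
          + ((-1 : ℂ) ^ k) • (an N i * ad N (i + ((k - 1 : ℕ) : ZMod N)))
          + ad N i * an N (i + ((k - 3 : ℕ) : ZMod N))
          + ((-1 : ℂ) ^ k) • (an N i * ad N (i + ((k - 3 : ℕ) : ZMod N)))
          + (1 + (-1 : ℂ) ^ k) •
              (c20 • (ad N i * ad N (i + ((k - 2 : ℕ) : ZMod N))) + c10 • ad N i)))
        + c40 • ∑ n ∈ Finset.range (k / 2), Dop N (k - n - 1) n) :
    ⁅Q, H⁆ = 0 := by
  obtain ⟨k, rfl⟩ := Nat.exists_eq_add_of_le' hk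
  have had (i : ZMod N) : ad N i = Algebra.lmul ℂ _ (X i) := rfl
  obtain ⟨κ₁, h₁⟩ := exists_sum_an_mul_ad (N := N) ((k + 2 : ℕ) : ZMod N)
  obtain ⟨κ₂, h₂⟩ := exists_sum_an_mul_ad (N := N) (k : ZMod N)
  set s : ℂ := (-1) ^ (k + 3) with hs
  have hs' : (-1 : ℂ) ^ (k + 1) = s := by rw [hs]; ring
  have hops : ∑ i, ad N (i + 1) * an N i = (hop N (-1)).toLinearMap := by
    rw [← sum_ad_mul_an, ← sum_site_shift 1 fun i ↦ ad N i * an N (i + -1)]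
    simp
  have hH' : H = (hop N 1 + hop N (-1)).toLinearMap + Algebra.lmul ℂ _
      (c40 • ∑ i, X i ^ 4 + c20 • ∑ i, X i ^ 2 + c10 • ∑ i, X i) := by
    simp only [hH, Finset.sum_add_distrib, sum_ad_mul_an, hops, ← Finset.smul_sum]
    simp only [had, map_add, map_smul, map_sum, map_pow, Derivation.coe_add_linearMap]
    abel
  have hlayers : ∑ n ∈ Finset.range ((k + 3) / 2), Dop N (k + 3 - n - 1) n = Algebra.lmul ℂ _
      (∑ n ∈ Finset.range ((k + 1) / 2 + 1), layer (quartic N) n (k + 1 - 2 * n)) := by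
    rw [map_sum, show (k + 3) / 2 = (k + 1) / 2 + 1 by lia]
    refine Finset.sum_congr rfl fun n hn ↦ ?_
    have := Finset.mem_range.1 hn
    rw [← Dop_eq, show k + 3 - n - 1 = k + 1 - 2 * n + n + 1 by lia]
  have hQ' : Q = (hop N ((k + 2 : ℕ) : ZMod N) + s • hop N (-((k + 2 : ℕ) : ZMod N))
        + hop N (k : ZMod N) + s • hop N (-(k : ZMod N))).toLinearMap + (s * κ₁ + s * κ₂) • 1
      + Algebra.lmul ℂ _ ((1 + s) • (c20 • quadratic N ((k + 1 : ℕ) : ZMod N) + c10 • ∑ i, X i)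
        + c40 • ∑ n ∈ Finset.range ((k + 1) / 2 + 1), layer (quartic N) n (k + 1 - 2 * n)) := by
    rw [hQ, hlayers]
    simp only [Nat.add_sub_cancel, show k + 3 - 1 = k + 2 by lia, show k + 3 - 2 = k + 1 by lia,
      Finset.sum_add_distrib, ← Finset.smul_sum, sum_ad_mul_an, h₁, h₂]
    simp only [had, quadratic, map_add, map_smul, map_sum, map_mul,
      Derivation.coe_add_linearMap, Derivation.coe_smul_linearMap]
    module
  rw [hH', hQ']
  refine lie_derivation_add_lmul _ _ _ _ _ ?_ ?_
  · refine derivation_ext fun j ↦ ?_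
    rw [Derivation.commutator_apply]
    simp only [Derivation.add_apply, Derivation.smul_apply, Derivation.zero_apply, hop_X, map_add,
      Derivation.map_smul, sub_right_comm j 1, sub_right_comm j (-1)]
    module
  · have hl := (isHopping_quartic (N := N)).map_sum_layer isGapSymmetric_quartic k.succ_pos
    have e₁ := hop_sum_pow_four (N := N) (k + 2 : ℕ)
    have e₂ := hop_sum_pow_four (N := N) k
    have e₃ := hop_neg_sum_pow_four (N := N) (k + 2 : ℕ)
    have e₄ := hop_neg_sum_pow_four (N := N) k
    rw [Int.cast_natCast] at e₁ e₂ e₃ e₄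
    rw [Nat.succ_eq_add_one, hs', show ((k + 1 : ℕ) : ℤ) + 1 = (k + 2 : ℕ) by push_cast; ring,
      show ((k + 1 : ℕ) : ℤ) - 1 = k by push_cast; ring,
      Derivation.coeFn_coe] at hl
    rw [map_add _ _ (c40 • _), Derivation.map_smul _ c40, hl]
    simp only [Derivation.add_apply, Derivation.smul_apply, map_add, Derivation.map_smul,
      e₁, e₂, e₃, e₄,
      hop_sum_sq, hop_sum_X, hop_quadratic, quadratic_neg]
    rw [show ((k + 1 : ℕ) : ZMod N) + 1 = (k + 2 : ℕ) by push_cast; ring,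
      show ((k + 1 : ℕ) : ZMod N) - 1 = k by push_cast; ring,
      show ((k + 1 : ℕ) : ZMod N) + -1 = k by push_cast; ring,
      show ((k + 1 : ℕ) : ZMod N) - -1 = (k + 2 : ℕ) by push_cast; ring]
    module

end
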